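/- Suppose g ∈ H^t with t ≥ 1, the continuous function on 𝕌 with Fourier coefficients g is nonvanishing, and the equation 𝒞⁺u − (𝒞⁻u)·g = g − 1 has a unique solution u ∈ L², which moreover lies in H^t. Set φ⁺ = 1 + 𝒞⁺u and φ⁻ = 1 + 𝒞⁻u, both elements of H^t. Then φ⁺ is invertible in the convolution algebra H^t, i.e., there exists (φ⁺)^{−1} ∈ H^t with φ⁺·(φ⁺)^{−1} = 1, and the operator id − 𝓜(g−1)𝒞⁻ is invertible on L² with inverse (id − 𝓜(g−1)𝒞⁻)^{−1} = 𝓜(φ⁺)𝒞⁺𝓜((φ⁺)^{−1}) − 𝓜(φ⁻)𝒞⁻𝓜((φ⁺)^{−1}). -/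

import Mathlib

noncomputable section

open scoped BigOperators

/-- The Sobolev weight `max(1,|j|)`. -/
def wt (j : ℤ) : ℝ := max 1 |(j : ℝ)|

/-- Membership of a two-sided sequence in the Sobolev space `H^s`. -/
def hsumm (s : ℝ) (u : ℤ → ℂ) : Prop :=
  Summable fun j : ℤ => ‖u j‖ ^ 2 * wt j ^ (2 * s)

/-- The `H^s` norm of a two-sided sequence. -/
def hnorm (s : ℝ) (u : ℤ → ℂ) : ℝ :=
  Real.sqrt (∑' j : ℤ, ‖u j‖ ^ 2 * wt j ^ (2 * s))

/-- `N₋ = ⌊N/2⌋`. -/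
def Nmin (N : ℕ) : ℤ := (N : ℤ) / 2

/-- `N₊ = ⌊(N-1)/2⌋`. -/
def Npl (N : ℕ) : ℤ := ((N : ℤ) - 1) / 2

/-- The Fourier truncation projection `𝒫_N`. -/
def projP (N : ℕ) (u : ℤ → ℂ) : ℤ → ℂ :=
  fun j => if -Nmin N ≤ j ∧ j ≤ Npl N then u j else 0

/-- The trigonometric interpolation projection `𝓘_N` (via the aliasing formula). -/
def interpI (N : ℕ) (u : ℤ → ℂ) : ℤ → ℂ :=
  fun j => if -Nmin N ≤ j ∧ j ≤ Npl N then ∑' p : ℤ, u (p * (N : ℤ) + j) else 0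

/-- Membership in `ran 𝒫_N`. -/
def inPN (N : ℕ) (u : ℤ → ℂ) : Prop := projP N u = u

/-- The boundary value `𝒞⁺` of the Cauchy transform: keep the nonnegative modes. -/
def Cpl (u : ℤ → ℂ) : ℤ → ℂ := fun j => if 0 ≤ j then u j else 0

/-- The boundary value `𝒞⁻` of the Cauchy transform: `-1` times the negative modes. -/
def Cmn (u : ℤ → ℂ) : ℤ → ℂ := fun j => if j < 0 then -u j else 0

/-- Multiplication of functions on `𝕌`, i.e. convolution of Fourier coefficients:
`𝓜(g)u = g·u`. -/
def cmul (g u : ℤ → ℂ) : ℤ → ℂ := fun n => ∑' j : ℤ, g (n - j) * u j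

/-- The Fourier coefficients of the constant function `1`. -/
def one1 : ℤ → ℂ := fun j => if j = 0 then 1 else 0
/-- The continuous function on `𝕌` with Fourier coefficients `g` is nonvanishing:
`min_{z ∈ 𝕌} |g(z)| > 0`. -/
def nonvanishing (g : ℤ → ℂ) : Prop :=
  ∃ ε : ℝ, 0 < ε ∧ ∀ θ : ℝ,
    ε ≤ ‖∑' j : ℤ, g j * Complex.exp (Complex.I * (j : ℂ) * (θ : ℂ))‖

/-- The Toeplitz operator `𝒯(g) = 𝒞⁺ 𝓜(g) 𝒞⁺`. -/
def Topl (g u : ℤ → ℂ) : ℤ → ℂ := Cpl (cmul g (Cpl u))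


/-! ### Real and complex sequences -/

theorem sq_tsum_le_of_sq_eq_mul {r f g : ℤ → ℝ} (hf0 : ∀ i, 0 ≤ f i) (hg0 : ∀ i, 0 ≤ g i)
    (hr0 : ∀ i, 0 ≤ r i) (h : ∀ i, r i ^ 2 = f i * g i) (hf : Summable f) (hg : Summable g) :
    Summable r ∧ (∑' i, r i) ^ 2 ≤ (∑' i, f i) * ∑' i, g i := by
  have hr : Summable r := by
    refine Summable.of_nonneg_of_le hr0 (fun i => ?_) (hf.add hg)
    have := h i
    nlinarith [hf0 i, hg0 i, hr0 i, mul_nonneg (hf0 i) (hg0 i)]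
  refine ⟨hr, le_of_tendsto_of_tendsto' (Filter.Tendsto.pow hr.hasSum 2)
    (Filter.Tendsto.mul hf.hasSum hg.hasSum) fun s => ?_⟩
  exact Finset.sum_sq_le_sum_mul_sum_of_sq_le_mul s (fun i _ => hf0 i) (fun i _ => hg0 i)
    fun i _ => (h i).le

/-- The change of variables `(n, j) ↦ (n - j, j)`. -/
def subEquiv : ℤ × ℤ ≃ ℤ × ℤ where
  toFun p := (p.1 - p.2, p.2)
  invFun p := (p.1 + p.2, p.2)
  left_inv p := by simp
  right_inv p := by simp

theorem bdd_of_summable_sq {b : ℤ → ℝ} (hb : Summable fun j => b j ^ 2) :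
    ∃ C, ∀ j, |b j| ≤ C := by
  refine ⟨Real.sqrt (∑' j, b j ^ 2), fun j => Real.abs_le_sqrt ?_⟩
  exact hb.le_tsum j fun _ _ => sq_nonneg _

theorem summable_conv_of_bdd {a b : ℤ → ℝ} (ha : Summable a) (ha0 : ∀ j, 0 ≤ a j)
    (hb0 : ∀ j, 0 ≤ b j) {C : ℝ} (hb : ∀ j, |b j| ≤ C) (n : ℤ) :
    Summable fun j => a (n - j) * b j := by
  have h1 : Summable fun j => a (n - j) := (Equiv.subLeft n).summable_iff.2 ha
  refine Summable.of_nonneg_of_le (fun j => mul_nonneg (ha0 _) (hb0 _)) (fun j => ?_)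
    (h1.mul_right C)
  exact mul_le_mul_of_nonneg_left ((le_abs_self _).trans (hb j)) (ha0 _)

theorem summable_sq_conv {a b : ℤ → ℝ} (ha : Summable a) (ha0 : ∀ j, 0 ≤ a j)
    (hb : Summable fun j => b j ^ 2) (hb0 : ∀ j, 0 ≤ b j) :
    Summable fun n => (∑' j, a (n - j) * b j) ^ 2 := by
  have h1 : Summable fun p : ℤ × ℤ => a p.1 * b p.2 ^ 2 :=
    ha.mul_of_nonneg hb ha0 fun j => sq_nonneg _
  have h2 : Summable fun p : ℤ × ℤ => a (p.1 - p.2) * b p.2 ^ 2 :=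
    (subEquiv.summable_iff (f := fun p : ℤ × ℤ => a p.1 * b p.2 ^ 2)).2 h1
  have h3 : Summable fun n => ∑' j, a (n - j) * b j ^ 2 := h2.prod
  refine Summable.of_nonneg_of_le (fun n => sq_nonneg _) (fun n => ?_) (h3.mul_left (∑' i, a i))
  have h4 : Summable fun j => a (n - j) := (Equiv.subLeft n).summable_iff.2 ha
  have h5 : ∑' j, a (n - j) = ∑' j, a j := (Equiv.subLeft n).tsum_eq a
  rw [← h5]
  exact (sq_tsum_le_of_sq_eq_mul (fun j => ha0 _) (fun j => mul_nonneg (ha0 _) (sq_nonneg _))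
    (fun j => mul_nonneg (ha0 _) (hb0 _)) (fun j => by ring) h4 (h2.prod_factor n)).2

theorem tsum_conv_comm {R : Type*} [CommSemiring R] [TopologicalSpace R] (a b : ℤ → R) (n : ℤ) :
    ∑' j, a (n - j) * b j = ∑' j, b (n - j) * a j := by
  rw [← (Equiv.subLeft n).tsum_eq]
  exact tsum_congr fun j => by simp [mul_comm]

/-- Absolutely summable sequences. -/
def AbsSummable (a : ℤ → ℂ) : Prop := Summable fun j => ‖a j‖

/-- Bounded sequences. -/
def BddSeq (a : ℤ → ℂ) : Prop := ∃ C, ∀ j, ‖a j‖ ≤ C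

theorem cmul_comm (a b : ℤ → ℂ) : cmul a b = cmul b a :=
  funext fun n => tsum_conv_comm a b n

theorem AbsSummable.bddSeq {a : ℤ → ℂ} (ha : AbsSummable a) : BddSeq a :=
  ⟨∑' j, ‖a j‖, fun j => Summable.le_tsum ha j fun _ _ => norm_nonneg _⟩

theorem AbsSummable.add {a b : ℤ → ℂ} (ha : AbsSummable a) (hb : AbsSummable b) :
    AbsSummable (a + b) :=
  Summable.of_nonneg_of_le (fun _ => norm_nonneg _) (fun _ => norm_add_le _ _)
    (Summable.add ha hb)

theorem AbsSummable.neg {a : ℤ → ℂ} (ha : AbsSummable a) : AbsSummable (-a) := by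
  simpa [AbsSummable] using ha

theorem summable_norm_cmul {a b : ℤ → ℂ} (ha : AbsSummable a) (hb : BddSeq b) (n : ℤ) :
    Summable fun j => ‖a (n - j)‖ * ‖b j‖ := by
  obtain ⟨C, hC⟩ := hb
  exact summable_conv_of_bdd (a := fun j => ‖a j‖) (b := fun j => ‖b j‖) ha
    (fun _ => norm_nonneg _) (fun _ => norm_nonneg _) (C := C) (fun j => by simpa using hC j) n

theorem summable_cmul {a b : ℤ → ℂ} (ha : AbsSummable a) (hb : BddSeq b) (n : ℤ) :
    Summable fun j => a (n - j) * b j := by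
  refine Summable.of_norm ?_
  simpa using summable_norm_cmul ha hb n

theorem cmul_add {a b c : ℤ → ℂ} (ha : AbsSummable a) (hb : BddSeq b) (hc : BddSeq c) :
    cmul a (b + c) = cmul a b + cmul a c := by
  funext n
  simp only [cmul, Pi.add_apply, mul_add]
  exact (summable_cmul ha hb n).tsum_add (summable_cmul ha hc n)

theorem cmul_neg (a b : ℤ → ℂ) : cmul a (-b) = -cmul a b := by
  funext n
  simp [cmul, tsum_neg]

theorem BddSeq.neg {a : ℤ → ℂ} (ha : BddSeq a) : BddSeq (-a) := by
  simpa [BddSeq] using ha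

theorem BddSeq.add {a b : ℤ → ℂ} (ha : BddSeq a) (hb : BddSeq b) : BddSeq (a + b) := by
  obtain ⟨A, hA⟩ := ha
  obtain ⟨B, hB⟩ := hb
  exact ⟨A + B, fun j => (norm_add_le _ _).trans (add_le_add (hA j) (hB j))⟩

theorem cmul_sub {a b c : ℤ → ℂ} (ha : AbsSummable a) (hb : BddSeq b) (hc : BddSeq c) :
    cmul a (b - c) = cmul a b - cmul a c := by
  rw [sub_eq_add_neg, cmul_add ha hb hc.neg, cmul_neg, ← sub_eq_add_neg]

theorem add_cmul {a b c : ℤ → ℂ} (ha : AbsSummable a) (hb : AbsSummable b) (hc : BddSeq c) :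
    cmul (a + b) c = cmul a c + cmul b c := by
  funext n
  simp only [cmul, Pi.add_apply, add_mul]
  exact (summable_cmul ha hc n).tsum_add (summable_cmul hb hc n)

theorem neg_cmul (a b : ℤ → ℂ) : cmul (-a) b = -cmul a b := by
  rw [cmul_comm, cmul_neg, cmul_comm]

theorem sub_cmul {a b c : ℤ → ℂ} (ha : AbsSummable a) (hb : AbsSummable b) (hc : BddSeq c) :
    cmul (a - b) c = cmul a c - cmul b c := by
  rw [sub_eq_add_neg, add_cmul ha hb.neg hc, neg_cmul, ← sub_eq_add_neg]

theorem one1_cmul (a : ℤ → ℂ) : cmul one1 a = a := by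
  funext n
  rw [cmul, tsum_eq_single n]
  · simp [one1]
  · intro j hj
    simp [one1, sub_eq_zero, hj.symm]

theorem absSummable_one1 : AbsSummable one1 :=
  summable_of_ne_finset_zero (s := {0}) fun j hj => by
    have : j ≠ 0 := by simpa using hj
    simp [one1, this]

theorem cmul_assoc {a b c : ℤ → ℂ} (ha : AbsSummable a) (hb : AbsSummable b) (hc : BddSeq c) :
    cmul (cmul a b) c = cmul a (cmul b c) := by
  funext n
  obtain ⟨C, hC⟩ := hc
  let e : ℤ × ℤ ≃ ℤ × ℤ :=
    { toFun := fun p => (n - p.1, p.1 - p.2)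
      invFun := fun p => (n - p.1, n - p.1 - p.2)
      left_inv := fun p => by simp
      right_inv := fun p => by simp }
  have h1 : Summable fun p : ℤ × ℤ => ‖a p.1‖ * ‖b p.2‖ :=
    Summable.mul_of_nonneg ha hb (fun _ => norm_nonneg _) fun _ => norm_nonneg _
  have h2 : Summable fun p : ℤ × ℤ => ‖a (n - p.1)‖ * ‖b (p.1 - p.2)‖ :=
    (e.summable_iff (f := fun p : ℤ × ℤ => ‖a p.1‖ * ‖b p.2‖)).2 h1
  have h3 : Summable (Function.uncurry fun k j : ℤ => a (n - k) * (b (k - j) * c j)) := by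
    refine Summable.of_norm_bounded (h2.mul_right C) fun p => ?_
    simp only [Function.uncurry, norm_mul, ← mul_assoc]
    exact mul_le_mul_of_nonneg_left (hC _) (by positivity)
  calc cmul (cmul a b) c n = ∑' j, ∑' k, a (n - k) * (b (k - j) * c j) := by
        refine tsum_congr fun j => ?_
        rw [cmul, ← tsum_mul_right, ← (Equiv.subRight j).tsum_eq]
        refine tsum_congr fun k => ?_
        simp [mul_assoc]
    _ = ∑' k, ∑' j, a (n - k) * (b (k - j) * c j) := h3.tsum_comm
    _ = cmul a (cmul b c) n := tsum_congr fun k => by rw [tsum_mul_left, cmul]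

/-! ### Weights and Sobolev spaces -/

theorem one_le_wt (j : ℤ) : 1 ≤ wt j := le_max_left _ _

theorem wt_pos (j : ℤ) : 0 < wt j := zero_lt_one.trans_le (one_le_wt j)

theorem wt_add_le (i j : ℤ) : wt (i + j) ≤ wt i + wt j := by
  have h1 := one_le_wt i
  have h2 := one_le_wt j
  refine max_le (by linarith) ?_
  push_cast
  exact (abs_add_le _ _).trans (add_le_add (le_max_right _ _) (le_max_right _ _))

theorem hsumm_iff {s : ℝ} {u : ℤ → ℂ} :
    hsumm s u ↔ Summable fun j => (‖u j‖ * wt j ^ s) ^ 2 := by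
  refine summable_congr fun j => ?_
  rw [mul_pow, ← Real.rpow_natCast, ← Real.rpow_natCast, ← Real.rpow_mul (wt_pos j).le]
  norm_num [mul_comm]

theorem hsumm_zero_iff {u : ℤ → ℂ} : hsumm 0 u ↔ Summable fun j => ‖u j‖ ^ 2 := by
  simp [hsumm]

theorem hsumm.mono {s r : ℝ} {u : ℤ → ℂ} (hu : hsumm r u) (hsr : s ≤ r) : hsumm s u := by
  refine Summable.of_nonneg_of_le (fun j => ?_) (fun j => ?_) hu
  · have := wt_pos j
    positivity
  · exact mul_le_mul_of_nonneg_left (Real.rpow_le_rpow_of_exponent_le (one_le_wt j) (by linarith))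
      (sq_nonneg _)

theorem hsumm.add {s : ℝ} {u v : ℤ → ℂ} (hu : hsumm s u) (hv : hsumm s v) : hsumm s (u + v) := by
  refine Summable.of_nonneg_of_le (fun j => ?_) (fun j => ?_)
    ((Summable.add hu hv).mul_left 2)
  · have := wt_pos j
    positivity
  · have h1 : 0 ≤ wt j ^ (2 * s) := Real.rpow_nonneg (wt_pos j).le _
    have h2 : ‖(u + v) j‖ ^ 2 ≤ 2 * (‖u j‖ ^ 2 + ‖v j‖ ^ 2) := by
      have := norm_add_le (u j) (v j)
      have h0 := norm_nonneg (u j + v j)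
      rw [Pi.add_apply]
      nlinarith [sq_nonneg (‖u j‖ - ‖v j‖)]
    nlinarith

theorem hsumm.of_norm_le {s : ℝ} {u v : ℤ → ℂ} (hu : hsumm s u) (h : ∀ j, ‖v j‖ ≤ ‖u j‖) :
    hsumm s v := by
  refine Summable.of_nonneg_of_le (fun j => ?_) (fun j => ?_) hu
  · have := wt_pos j
    positivity
  · have h1 : 0 ≤ wt j ^ (2 * s) := Real.rpow_nonneg (wt_pos j).le _
    gcongr
    exact h j

theorem hsumm.neg {s : ℝ} {u : ℤ → ℂ} (hu : hsumm s u) : hsumm s (-u) :=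
  hu.of_norm_le fun j => by simp

theorem hsumm.sub {s : ℝ} {u v : ℤ → ℂ} (hu : hsumm s u) (hv : hsumm s v) : hsumm s (u - v) := by
  rw [sub_eq_add_neg]
  exact hu.add hv.neg

theorem hsumm.Cpl {s : ℝ} {u : ℤ → ℂ} (hu : hsumm s u) : hsumm s (Cpl u) :=
  hu.of_norm_le fun j => by
    unfold _root_.Cpl
    split_ifs <;> simp

theorem hsumm.Cmn {s : ℝ} {u : ℤ → ℂ} (hu : hsumm s u) : hsumm s (Cmn u) :=
  hu.of_norm_le fun j => by
    unfold _root_.Cmn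
    split_ifs <;> simp

theorem hsumm_one1 (s : ℝ) : hsumm s one1 :=
  summable_of_ne_finset_zero (s := {0}) fun j hj => by
    have : j ≠ 0 := by simpa using hj
    simp [one1, this]

theorem hsumm.bddSeq {u : ℤ → ℂ} {s : ℝ} (hu : hsumm s u) (hs : 0 ≤ s) : BddSeq u := by
  obtain ⟨C, hC⟩ := bdd_of_summable_sq (hsumm_zero_iff.1 (hu.mono hs))
  exact ⟨C, fun j => by simpa using hC j⟩

theorem summable_wt_rpow {a : ℝ} (ha : 1 ≤ a) : Summable fun j => (wt j ^ (-a)) ^ 2 := by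
  have h1 : Summable fun j : ℤ => 1 / (j : ℝ) ^ 2 := Real.summable_one_div_int_pow.2 one_lt_two
  have h2 : Summable fun j : ℤ => if j = 0 then (1 : ℝ) else 0 :=
    summable_of_ne_finset_zero (s := {0}) fun j hj => by simpa using hj
  refine Summable.of_nonneg_of_le (fun j => sq_nonneg _) (fun j => ?_) (h1.add h2)
  have h3 : wt j ^ (-a) ≤ (wt j)⁻¹ := by
    rw [← Real.rpow_neg_one]
    exact Real.rpow_le_rpow_of_exponent_le (one_le_wt j) (by linarith)
  have h4 : 0 ≤ wt j ^ (-a) := Real.rpow_nonneg (wt_pos j).le _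
  refine (pow_le_pow_left₀ h4 h3 2).trans ?_
  by_cases hj : j = 0
  · simp [hj, wt]
  · have h5 : (0 : ℝ) < |(j : ℝ)| := by positivity
    simp only [hj, if_false, add_zero, inv_pow, one_div]
    rw [← sq_abs (j : ℝ)]
    gcongr
    exact le_max_right _ _

theorem summable_norm_mul_wt_rpow {a s : ℝ} (ha : 1 ≤ a) {u : ℤ → ℂ} (hu : hsumm s u) :
    Summable fun j => ‖u j‖ * wt j ^ (s - a) := by
  refine (sq_tsum_le_of_sq_eq_mul (fun j => sq_nonneg _) (fun j => sq_nonneg _) (fun j => ?_)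
    (fun j => ?_) (hsumm_iff.1 hu) (summable_wt_rpow ha)).1
  · exact mul_nonneg (norm_nonneg _) (Real.rpow_nonneg (wt_pos j).le _)
  · rw [sub_eq_add_neg, Real.rpow_add (wt_pos j)]
    ring

theorem hsumm.absSummable {a : ℝ} (ha : 1 ≤ a) {u : ℤ → ℂ} (hu : hsumm a u) : AbsSummable u := by
  simpa [AbsSummable] using summable_norm_mul_wt_rpow ha hu

theorem wt_rpow_le {s a : ℝ} (hs : 0 ≤ s) (hsa : s ≤ a) (i j : ℤ) :
    wt (i + j) ^ s ≤ 2 ^ s * (wt i ^ a * wt j ^ (s - a) + wt j ^ s) := by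
  have hi := wt_pos i
  have hj := wt_pos j
  rcases le_total (wt i) (wt j) with h | h
  · calc wt (i + j) ^ s ≤ (2 * wt j) ^ s :=
          Real.rpow_le_rpow (wt_pos _).le (by linarith [wt_add_le i j]) hs
      _ = 2 ^ s * wt j ^ s := Real.mul_rpow (by norm_num) hj.le
      _ ≤ _ := by
        gcongr
        have : 0 ≤ wt i ^ a * wt j ^ (s - a) := by positivity
        linarith
  · calc wt (i + j) ^ s ≤ (2 * wt i) ^ s :=
          Real.rpow_le_rpow (wt_pos _).le (by linarith [wt_add_le i j]) hs
      _ = 2 ^ s * (wt i ^ a * wt i ^ (s - a)) := by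
        rw [Real.mul_rpow (by norm_num) hi.le, ← Real.rpow_add hi]
        ring_nf
      _ ≤ 2 ^ s * (wt i ^ a * wt j ^ (s - a)) := by
        have := Real.rpow_le_rpow_of_nonpos hj h (show s - a ≤ 0 by linarith)
        gcongr
      _ ≤ _ := by
        gcongr
        have : 0 ≤ wt j ^ s := by positivity
        linarith

/-- `H^a · H^s ⊆ H^s` for `a ≥ 1` and `0 ≤ s ≤ a`. -/
theorem hsumm.cmul {a s : ℝ} (ha : 1 ≤ a) (hs : 0 ≤ s) (hsa : s ≤ a) {f g : ℤ → ℂ}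
    (hf : hsumm a f) (hg : hsumm s g) : hsumm s (cmul f g) := by
  have hw : ∀ (r : ℝ) (j : ℤ), 0 ≤ wt j ^ r := fun r j => Real.rpow_nonneg (wt_pos j).le _
  set A : ℤ → ℝ := fun j => ‖f j‖ * wt j ^ a with hA
  set B : ℤ → ℝ := fun j => ‖g j‖ * wt j ^ (s - a) with hB
  set A' : ℤ → ℝ := fun j => ‖f j‖ with hA'
  set B' : ℤ → ℝ := fun j => ‖g j‖ * wt j ^ s with hB'
  have hA0 : ∀ j, 0 ≤ A j := fun j => mul_nonneg (norm_nonneg _) (hw _ _)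
  have hB0 : ∀ j, 0 ≤ B j := fun j => mul_nonneg (norm_nonneg _) (hw _ _)
  have hA'0 : ∀ j, 0 ≤ A' j := fun j => norm_nonneg _
  have hB'0 : ∀ j, 0 ≤ B' j := fun j => mul_nonneg (norm_nonneg _) (hw _ _)
  have sA : Summable fun j => A j ^ 2 := hsumm_iff.1 hf
  have sB : Summable B := summable_norm_mul_wt_rpow ha hg
  have sA' : Summable A' := hf.absSummable ha
  have sB' : Summable fun j => B' j ^ 2 := hsumm_iff.1 hg
  obtain ⟨CA, hCA⟩ := bdd_of_summable_sq sA
  obtain ⟨CB, hCB⟩ := bdd_of_summable_sq sB'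
  have t1 : ∀ n, Summable fun j => A (n - j) * B j := fun n => by
    have := (Equiv.subLeft n).summable_iff.2 (summable_conv_of_bdd sB hB0 hA0 hCA n)
    refine this.congr fun j => ?_
    simp [mul_comm]
  have t2 : ∀ n, Summable fun j => A' (n - j) * B' j :=
    summable_conv_of_bdd sA' hA'0 hB'0 hCB
  have y1 : Summable fun n => (∑' j, A (n - j) * B j) ^ 2 := by
    simp_rw [tsum_conv_comm A B]
    exact summable_sq_conv sB hB0 sA hA0
  have y2 : Summable fun n => (∑' j, A' (n - j) * B' j) ^ 2 := summable_sq_conv sA' hA'0 sB' hB'0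
  refine hsumm_iff.2 (Summable.of_nonneg_of_le (fun _ => sq_nonneg _) (fun n => ?_)
    ((y1.add y2).mul_left (2 * (2 ^ s) ^ 2)))
  have key : ‖_root_.cmul f g n‖ * wt n ^ s
      ≤ 2 ^ s * (∑' j, A (n - j) * B j + ∑' j, A' (n - j) * B' j) := by
    have h1 := summable_norm_cmul (hf.absSummable ha) (hg.bddSeq hs) n
    calc ‖_root_.cmul f g n‖ * wt n ^ s
        ≤ (∑' j, ‖f (n - j)‖ * ‖g j‖) * wt n ^ s := by
          refine mul_le_mul_of_nonneg_right ?_ (hw _ _)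
          simpa [_root_.cmul] using
            norm_tsum_le_tsum_norm (f := fun j => f (n - j) * g j) (by simpa using h1)
      _ = ∑' j, ‖f (n - j)‖ * ‖g j‖ * wt n ^ s := tsum_mul_right.symm
      _ ≤ ∑' j, 2 ^ s * (A (n - j) * B j + A' (n - j) * B' j) := by
          refine (h1.mul_right _).tsum_le_tsum (fun j => ?_) (((t1 n).add (t2 n)).mul_left _)
          have h2 := wt_rpow_le hs hsa (n - j) j
          rw [sub_add_cancel] at h2
          calc _ ≤ ‖f (n - j)‖ * ‖g j‖ *
                (2 ^ s * (wt (n - j) ^ a * wt j ^ (s - a) + wt j ^ s)) := by gcongr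
            _ = _ := by simp only [hA, hB, hA', hB']; ring
      _ = _ := by rw [tsum_mul_left, (t1 n).tsum_add (t2 n)]
  have h0 : 0 ≤ ‖_root_.cmul f g n‖ * wt n ^ s := mul_nonneg (norm_nonneg _) (hw _ _)
  refine (pow_le_pow_left₀ h0 key 2).trans ?_
  rw [mul_pow, mul_comm 2, mul_assoc]
  refine mul_le_mul_of_nonneg_left ?_ (sq_nonneg _)
  nlinarith [sq_nonneg ((∑' j, A (n - j) * B j) - ∑' j, A' (n - j) * B' j)]

/-! ### Derivatives and regularity of inverses -/

/-- The sequence of `-i ∂_θ u`, i.e. the Fourier multiplier `j`. -/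
def derivSeq (u : ℤ → ℂ) : ℤ → ℂ := fun j => (j : ℂ) * u j

theorem hsumm.derivSeq {s : ℝ} {u : ℤ → ℂ} (hu : hsumm (s + 1) u) : hsumm s (derivSeq u) := by
  refine hsumm_iff.2 (Summable.of_nonneg_of_le (fun _ => sq_nonneg _) (fun j => ?_)
    (hsumm_iff.1 hu))
  have h1 := wt_pos j
  rw [Real.rpow_add_one h1.ne', _root_.derivSeq, norm_mul, Complex.norm_intCast]
  refine pow_le_pow_left₀ (by positivity) ?_ 2
  calc |(j : ℝ)| * ‖u j‖ * wt j ^ s ≤ wt j * ‖u j‖ * wt j ^ s := by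
        gcongr
        exact le_max_right _ _
    _ = _ := by ring

theorem hsumm_of_derivSeq {s : ℝ} {u : ℤ → ℂ} (hu : hsumm s (derivSeq u)) : hsumm (s + 1) u := by
  have h2 : Summable fun j : ℤ => if j = 0 then ‖u 0‖ ^ 2 else 0 :=
    summable_of_ne_finset_zero (s := {0}) fun j hj => by
      have : j ≠ 0 := by simpa using hj
      simp [this]
  refine hsumm_iff.2 (Summable.of_nonneg_of_le (fun _ => sq_nonneg _) (fun j => ?_)
    ((hsumm_iff.1 hu).add h2))
  have h1 := wt_pos j
  rw [Real.rpow_add_one h1.ne', derivSeq, norm_mul, Complex.norm_intCast]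
  by_cases hj : j = 0
  · simp [hj, wt]
  · have h3 : wt j = |(j : ℝ)| := by
      refine max_eq_right ?_
      exact_mod_cast Int.one_le_abs hj
    simp only [hj, if_false, add_zero]
    rw [← h3]
    exact le_of_eq (by ring)

theorem derivSeq_cmul {a b : ℤ → ℂ} (ha : AbsSummable a) (hb : AbsSummable b)
    (ha' : BddSeq (derivSeq a)) (hb' : BddSeq (derivSeq b)) :
    derivSeq (cmul a b) = cmul (derivSeq a) b + cmul a (derivSeq b) := by
  funext n
  have h1 := summable_cmul ha hb' n
  have h2 : Summable fun j => derivSeq a (n - j) * b j := by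
    have := (Equiv.subLeft n).summable_iff.2 (summable_cmul hb ha' n)
    refine this.congr fun j => ?_
    simp [mul_comm]
  rw [Pi.add_apply, cmul, cmul, ← h2.tsum_add h1, derivSeq, cmul, ← tsum_mul_left]
  refine tsum_congr fun j => ?_
  simp only [derivSeq]
  push_cast
  ring

theorem hsumm_inverse_step {t a : ℝ} (ha : 1 ≤ a) (hat : a ≤ t) {f ψ : ℤ → ℂ} (hf : hsumm t f)
    (hψ : hsumm a ψ) (h : cmul f ψ = one1) : hsumm (min (t - 1) a + 1) ψ := by
  have fs := hf.absSummable (ha.trans hat)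
  have ψs := hψ.absSummable ha
  have hDf : hsumm (t - 1) (derivSeq f) := hsumm.derivSeq (by simpa using hf)
  have hDψ : hsumm (a - 1) (derivSeq ψ) := hsumm.derivSeq (by simpa using hψ)
  have bDf := hDf.bddSeq (by linarith)
  have bDψ := hDψ.bddSeq (by linarith)
  have hs : 0 ≤ min (t - 1) a := le_min (by linarith) (by linarith)
  have hD : cmul f (derivSeq ψ) = -cmul ψ (derivSeq f) := by
    have h1 := derivSeq_cmul fs ψs bDf bDψ
    have h2 : derivSeq one1 = 0 := by
      funext j
      by_cases hj : j = 0 <;> simp [derivSeq, one1, hj]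
    rw [h, h2, cmul_comm (derivSeq f)] at h1
    exact (neg_eq_of_add_eq_zero_right h1.symm).symm
  have hD' : derivSeq ψ = -cmul ψ (cmul ψ (derivSeq f)) := by
    rw [← cmul_neg, ← hD, ← cmul_assoc ψs fs bDψ, cmul_comm ψ f, h, one1_cmul]
  refine hsumm_of_derivSeq ?_
  rw [hD']
  have hm := min_le_right (t - 1) a
  exact (hsumm.cmul ha hs hm hψ (hsumm.cmul ha hs hm hψ (hDf.mono (min_le_left _ _)))).neg

theorem hsumm_inverse {t : ℝ} (ht : 1 ≤ t) {f ψ : ℤ → ℂ} (hf : hsumm t f)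
    (hψ : hsumm 1 ψ) (h : cmul f ψ = one1) : hsumm t ψ := by
  have key : ∀ n : ℕ, hsumm (min t (1 + n)) ψ := by
    intro n
    induction n with
    | zero => simpa [min_eq_right ht] using hψ
    | succ n ih =>
      have hn : (0 : ℝ) ≤ n := n.cast_nonneg
      refine (hsumm_inverse_step (le_min ht (by linarith)) (min_le_left _ _) hf ih h).mono ?_
      rw [← min_add_add_right]
      refine le_min (by simp) ?_
      rw [← min_add_add_right]
      refine le_min ((min_le_left _ _).trans (by linarith)) ((min_le_right _ _).trans ?_)
      push_cast
      linarith
  obtain ⟨n, hn⟩ := exists_nat_ge t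
  exact (key n).mono (le_min le_rfl (by linarith))

/-! ### Division by a nonvanishing function -/

theorem norm_fourier_apply (n : ℤ) (x : UnitAddCircle) : ‖(fourier n x : ℂ)‖ = 1 := by
  rw [fourier_apply]
  exact Circle.norm_coe _

open AddCircle in
/-- The `n`-th Fourier coefficient as a continuous functional on continuous functions. -/
def fourierCoeffL (n : ℤ) : C(UnitAddCircle, ℂ) →L[ℂ] ℂ :=
  LinearMap.mkContinuous
    { toFun := fun H => fourierCoeff H n
      map_add' := fun H K => congrFun (fourierCoeff.add
        (H.continuous.integrable_of_hasCompactSupport (HasCompactSupport.of_compactSpace _))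
        (K.continuous.integrable_of_hasCompactSupport (HasCompactSupport.of_compactSpace _))) n
      map_smul' := fun c H => fourierCoeff.const_smul H c n } 1 fun H => by
    have h := MeasureTheory.norm_integral_le_of_norm_le_const (μ := haarAddCircle)
      (f := fun x : UnitAddCircle => fourier (-n) x • H x) (C := ‖H‖)
      (Filter.Eventually.of_forall fun x => by
        rw [norm_smul, norm_fourier_apply, one_mul]
        exact H.norm_coe_le_norm x)
    simpa [fourierCoeff] using h

theorem fourierCoeffL_apply (n : ℤ) (H : C(UnitAddCircle, ℂ)) :
    fourierCoeffL n H = fourierCoeff H n := rfl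

theorem fourierCoeffL_fourier_mul (n j : ℤ) (H : C(UnitAddCircle, ℂ)) :
    fourierCoeffL n (fourier j * H) = fourierCoeffL (n - j) H := by
  simp only [fourierCoeffL_apply, fourierCoeff]
  refine congrArg (fun k : UnitAddCircle → ℂ => ∫ x, k x ∂AddCircle.haarAddCircle)
    (funext fun x => ?_)
  have : -(n - j) = -n + j := by ring
  simp only [smul_eq_mul, ContinuousMap.mul_apply, this, fourier_add]
  ring

theorem fourierCoeffL_one (n : ℤ) : fourierCoeffL n 1 = one1 n := by
  have h := congrFun (fourierCoeff_fourier (T := 1) 0) n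
  have h0 : (fourier 0 : C(UnitAddCircle, ℂ)) = 1 := by
    ext x
    simp
  rw [h0] at h
  rw [fourierCoeffL_apply, h]
  simp [one1, Pi.single_apply]

theorem hasSum_sq_fourierCoeffL (H : C(UnitAddCircle, ℂ)) :
    HasSum (fun n => ‖fourierCoeffL n H‖ ^ 2) (∫ x, ‖H x‖ ^ 2 ∂AddCircle.haarAddCircle) := by
  have h := hasSum_sq_fourierCoeff (H.toLp 2 AddCircle.haarAddCircle ℂ)
  simp only [fourierCoeff_toLp] at h
  have h1 : (fun x => ‖H.toLp 2 AddCircle.haarAddCircle ℂ x‖ ^ 2)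
      =ᵐ[AddCircle.haarAddCircle] fun x => ‖H x‖ ^ 2 := by
    filter_upwards [H.coeFn_toLp (p := 2) (𝕜 := ℂ) AddCircle.haarAddCircle] with x hx
    rw [hx]
  rw [MeasureTheory.integral_congr_ae h1] at h
  exact h

/-- The translate `x ↦ H (x + h)`. -/
def translateC (h : UnitAddCircle) (H : C(UnitAddCircle, ℂ)) : C(UnitAddCircle, ℂ) :=
  H.comp ⟨fun x => x + h, by fun_prop⟩

theorem fourierCoeffL_translateC (n : ℤ) (h : UnitAddCircle) (H : C(UnitAddCircle, ℂ)) :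
    fourierCoeffL n (translateC h H) = fourier n h * fourierCoeffL n H := by
  simp only [fourierCoeffL_apply, fourierCoeff]
  have h1 := MeasureTheory.integral_add_right_eq_self (μ := AddCircle.haarAddCircle)
    (fun x : UnitAddCircle => fourier (-n) (x - h) • H x) h
  simp only [add_sub_cancel_right] at h1
  rw [← MeasureTheory.integral_const_mul]
  refine h1.trans (MeasureTheory.integral_congr_ae (Filter.Eventually.of_forall fun x => ?_))
  have h2 : fourier (-n) (x - h) = fourier (-n) x * fourier n h := by
    simp [fourier_apply, sub_eq_add_neg, AddCircle.toCircle_add]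
  simp only [h2, smul_eq_mul]
  ring

/-- Parseval's identity for a difference of translates. -/
theorem hasSum_sq_fourierCoeffL_translate_sub (h : UnitAddCircle) (H : C(UnitAddCircle, ℂ)) :
    HasSum (fun n => ‖(fourier n h - 1) * fourierCoeffL n H‖ ^ 2)
      (∫ x, ‖H (x + h) - H x‖ ^ 2 ∂AddCircle.haarAddCircle) := by
  have h1 := hasSum_sq_fourierCoeffL (translateC h H - H)
  have h2 : ∀ n, fourierCoeffL n (translateC h H - H) = (fourier n h - 1) * fourierCoeffL n H :=
    fun n => by rw [map_sub, fourierCoeffL_translateC, sub_one_mul]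
  simp_rw [h2] at h1
  exact h1

theorem norm_fourier_sub_one_le (n : ℤ) (h : ℝ) :
    ‖(fourier n (h : UnitAddCircle) : ℂ) - 1‖ ≤ 2 * Real.pi * |h| * |(n : ℝ)| := by
  have h1 := Real.norm_exp_I_mul_ofReal_sub_one_le (x := 2 * Real.pi * n * h)
  have h2 : Complex.I * ((2 * Real.pi * n * h : ℝ) : ℂ) = 2 * Real.pi * Complex.I * n * h := by
    push_cast
    ring
  rw [h2] at h1
  rw [fourier_coe_apply]
  simp only [Complex.ofReal_one, div_one]
  refine h1.trans (le_of_eq ?_)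
  rw [Real.norm_eq_abs, abs_mul, abs_mul, abs_mul, abs_of_pos Real.pi_pos, abs_two]
  ring

theorem summable_sq_derivSeq_of_translate_le {K : ℝ} {ψ : ℤ → ℂ}
    (hK : ∀ (h : ℝ) (S : Finset ℤ),
      ∑ n ∈ S, ‖(fourier n (h : UnitAddCircle) - 1) * ψ n‖ ^ 2 ≤ h ^ 2 * K) :
    Summable fun n => ‖derivSeq ψ n‖ ^ 2 := by
  have hlim : ∀ n : ℤ, Filter.Tendsto
      (fun h : ℝ => ‖(h⁻¹ • ((fourier n (h : UnitAddCircle) : ℂ) - 1)) * ψ n‖ ^ 2)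
      (nhdsWithin 0 {0}ᶜ) (nhds (‖(2 * Real.pi * Complex.I * n) * ψ n‖ ^ 2)) := by
    intro n
    have h1 := (hasDerivAt_fourier 1 n 0).tendsto_slope_zero
    simp only [zero_add, AddCircle.coe_zero, fourier_eval_zero, mul_one, Complex.ofReal_one,
      div_one] at h1
    exact ((h1.mul_const (ψ n)).norm).pow 2
  have hb : ∀ S : Finset ℤ, ∑ n ∈ S, ‖(2 * Real.pi * Complex.I * n) * ψ n‖ ^ 2 ≤ K := by
    intro S
    refine le_of_tendsto (tendsto_finsetSum S fun n _ => hlim n) ?_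
    filter_upwards [self_mem_nhdsWithin] with h hh
    have hh0 : h ≠ 0 := hh
    have hpos : 0 < h ^ 2 := by positivity
    have h2 := hK h S
    have h3 : ∀ n : ℤ, ‖(h⁻¹ • ((fourier n (h : UnitAddCircle) : ℂ) - 1)) * ψ n‖ ^ 2
        = (h ^ 2)⁻¹ * ‖(fourier n (h : UnitAddCircle) - 1) * ψ n‖ ^ 2 := by
      intro n
      rw [smul_mul_assoc, norm_smul, mul_pow]
      simp
    simp_rw [h3]
    rw [← Finset.mul_sum, inv_mul_le_iff₀ hpos]
    exact h2
  have hs : Summable fun n : ℤ => ‖(2 * Real.pi * Complex.I * n) * ψ n‖ ^ 2 :=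
    summable_of_sum_le (fun _ => sq_nonneg _) hb
  refine Summable.of_nonneg_of_le (fun _ => sq_nonneg _) (fun n => ?_) hs
  have hpi : (1 : ℝ) ≤ 2 * Real.pi := by linarith [Real.pi_gt_three]
  rw [mul_assoc (2 * Real.pi * Complex.I), norm_mul (2 * Real.pi * Complex.I), derivSeq]
  refine pow_le_pow_left₀ (norm_nonneg _) ?_ 2
  have h4 : ‖(2 * Real.pi * Complex.I : ℂ)‖ = 2 * Real.pi := by
    simp [abs_of_pos Real.pi_pos]
  rw [h4]
  exact le_mul_of_one_le_left (norm_nonneg _) hpi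

/-- A nonvanishing function in `H¹` has a reciprocal in `H¹`. -/
theorem exists_hsumm_one_inverse {f : ℤ → ℂ} (hf : hsumm 1 f)
    (hz : ∀ z : ℂ, ‖z‖ = 1 → ∑' j : ℤ, f j * z ^ j ≠ 0) :
    ∃ ψ : ℤ → ℂ, hsumm 1 ψ ∧ cmul f ψ = one1 := by
  have fs := hf.absSummable le_rfl
  have hsum : Summable fun j : ℤ => f j • (fourier j : C(UnitAddCircle, ℂ)) := by
    refine Summable.of_norm ?_
    refine Summable.congr fs fun j => ?_
    rw [norm_smul, fourier_norm, mul_one]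
  obtain ⟨F, hF⟩ := hsum
  have hF0 : ∀ x, F x ≠ 0 := by
    intro x
    have h1 : HasSum (fun j : ℤ => f j * (AddCircle.toCircle x : ℂ) ^ j) (F x) := by
      refine (ContinuousMap.hasSum_apply hF x).congr_fun fun j => ?_
      rw [ContinuousMap.smul_apply, smul_eq_mul, fourier_apply, AddCircle.toCircle_zsmul]
      rfl
    rw [← h1.tsum_eq]
    exact hz _ (Circle.norm_coe _)
  let G : C(UnitAddCircle, ℂ) := ⟨fun x => (F x)⁻¹, F.continuous.inv₀ hF0⟩
  have hFG : F * G = 1 := by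
    ext x
    exact mul_inv_cancel₀ (hF0 x)
  have hFf : ∀ n, fourierCoeffL n F = f n := by
    intro n
    have h1 := (fourierCoeffL n).hasSum hF
    have h2 : ∀ j, fourierCoeffL n (f j • fourier j) = if j = n then f n else 0 := by
      intro j
      rw [map_smul, ← mul_one (fourier j), fourierCoeffL_fourier_mul, fourierCoeffL_one]
      by_cases hj : j = n
      · simp [hj, one1]
      · simp [hj, one1, sub_eq_zero, Ne.symm hj]
    simp_rw [h2] at h1
    exact h1.unique (hasSum_ite_eq n (f n))
  set ψ : ℤ → ℂ := fun n => fourierCoeffL n G with hψ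
  refine ⟨ψ, ?_, ?_⟩
  · have hsq : Summable fun n => ‖derivSeq f n‖ ^ 2 :=
      hsumm_zero_iff.1 (hsumm.derivSeq (by simpa using hf))
    set K := ∑' n, ‖derivSeq f n‖ ^ 2
    have hFh : ∀ h : ℝ, ∫ x : UnitAddCircle, ‖F (x + h) - F x‖ ^ 2 ∂AddCircle.haarAddCircle
        ≤ h ^ 2 * ((2 * Real.pi) ^ 2 * K) := by
      intro h
      refine hasSum_le (fun n => ?_) (hasSum_sq_fourierCoeffL_translate_sub (h : UnitAddCircle) F)
        ((hsq.hasSum.mul_left _).mul_left _)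
      rw [hFf, norm_mul, derivSeq, norm_mul, Complex.norm_intCast, mul_pow, mul_pow]
      have := pow_le_pow_left₀ (norm_nonneg _) (norm_fourier_sub_one_le n h) 2
      rw [mul_pow, mul_pow, sq_abs h] at this
      calc _ ≤ (2 * Real.pi) ^ 2 * h ^ 2 * |(n : ℝ)| ^ 2 * ‖f n‖ ^ 2 := by gcongr
        _ = _ := by ring
    have hGh : ∀ h : ℝ, ∫ x : UnitAddCircle, ‖G (x + h) - G x‖ ^ 2 ∂AddCircle.haarAddCircle
        ≤ ‖G‖ ^ 4 * ∫ x : UnitAddCircle, ‖F (x + h) - F x‖ ^ 2 ∂AddCircle.haarAddCircle := by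
      intro h
      rw [← MeasureTheory.integral_const_mul]
      have hint : ∀ k : UnitAddCircle → ℝ, Continuous k →
          MeasureTheory.Integrable k AddCircle.haarAddCircle := fun k hk =>
        hk.integrable_of_hasCompactSupport (HasCompactSupport.of_compactSpace _)
      refine MeasureTheory.integral_mono (hint _ (by fun_prop)) (hint _ (by fun_prop)) fun x => ?_
      have h1 : G (x + h) - G x = -(G (x + h) * G x * (F (x + h) - F x)) := by
        have a1 := hF0 x
        have a2 := hF0 (x + h)
        simp only [G, ContinuousMap.coe_mk]
        field_simp
        ring
      simp only [h1, norm_neg, norm_mul, mul_pow]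
      have b1 := pow_le_pow_left₀ (norm_nonneg _) (G.norm_coe_le_norm (x + h)) 2
      have b2 := pow_le_pow_left₀ (norm_nonneg _) (G.norm_coe_le_norm x) 2
      calc _ ≤ ‖G‖ ^ 2 * ‖G‖ ^ 2 * ‖F (x + h) - F x‖ ^ 2 := by gcongr
        _ = _ := by ring
    have hD : Summable fun n => ‖derivSeq ψ n‖ ^ 2 := by
      refine summable_sq_derivSeq_of_translate_le (K := ‖G‖ ^ 4 * ((2 * Real.pi) ^ 2 * K))
        fun h S => ?_
      refine (sum_le_hasSum S (fun _ _ => sq_nonneg _)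
        (hasSum_sq_fourierCoeffL_translate_sub (h : UnitAddCircle) G)).trans ((hGh h).trans ?_)
      calc _ ≤ ‖G‖ ^ 4 * (h ^ 2 * ((2 * Real.pi) ^ 2 * K)) := by gcongr; exact hFh h
        _ = _ := by ring
    simpa using hsumm_of_derivSeq (hsumm_zero_iff.2 hD)
  · funext n
    have h1 := (fourierCoeffL n).hasSum (hF.mul_right G)
    rw [hFG, fourierCoeffL_one] at h1
    rw [cmul_comm, ← h1.tsum_eq]
    refine tsum_congr fun j => ?_
    rw [smul_mul_assoc, map_smul, fourierCoeffL_fourier_mul, smul_eq_mul, mul_comm]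

/-! ### Division by a boundary zero -/

theorem sum_sq_le_of_recurrence {a S : ℕ → ℝ} (hS : ∀ j, S j = S (j + 1) + a (j + 1)) (N : ℕ) :
    ∑ j ∈ Finset.range N, S j ^ 2
      ≤ 2 * N * S N ^ 2 + 4 * ∑ j ∈ Finset.range (N + 1), ((j : ℝ) * a j) ^ 2 := by
  induction N with
  | zero => simp
  | succ N ih =>
    rw [Finset.sum_range_succ, Finset.sum_range_succ _ (N + 1)]
    rw [hS N] at ih ⊢
    push_cast at ih ⊢
    have hN : (0 : ℝ) ≤ N := N.cast_nonneg
    nlinarith [sq_nonneg (S (N + 1) + a (N + 1) - 2 * (N + 1) * a (N + 1)),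
      mul_nonneg hN (sq_nonneg (a (N + 1))), sq_nonneg (a (N + 1))]

/-- The dual form of Hardy's inequality. -/
theorem summable_sq_tail {a : ℕ → ℝ} (ha : Summable a)
    (ha2 : Summable fun k : ℕ => ((k : ℝ) * a k) ^ 2) :
    Summable fun n => (∑' k, a (k + (n + 1))) ^ 2 := by
  refine summable_of_sum_range_le (c := 4 * ∑' k : ℕ, ((k : ℝ) * a k) ^ 2)
    (fun _ => sq_nonneg _) fun n => ?_
  have hT : ∀ j, ∑' k, a (k + (j + 1)) = ∑' k, a k - ∑ k ∈ Finset.range (j + 1), a k :=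
    fun j => by rw [← ha.sum_add_tsum_nat_add (j + 1)]; ring
  simp_rw [hT]
  have hlim : Filter.Tendsto (fun N => ∑ j ∈ Finset.range n,
      (∑ k ∈ Finset.range (N + 1), a k - ∑ k ∈ Finset.range (j + 1), a k) ^ 2) Filter.atTop
      (nhds (∑ j ∈ Finset.range n, (∑' k, a k - ∑ k ∈ Finset.range (j + 1), a k) ^ 2)) :=
    tendsto_finsetSum _ fun j _ => ((((Filter.tendsto_add_atTop_iff_nat 1).2
      ha.hasSum.tendsto_sum_nat).sub_const _).pow 2)
  refine le_of_tendsto hlim ?_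
  filter_upwards [Filter.eventually_ge_atTop n] with N hN
  have h1 := sum_sq_le_of_recurrence (a := a)
    (S := fun j => ∑ k ∈ Finset.range (N + 1), a k - ∑ k ∈ Finset.range (j + 1), a k)
    (fun j => by rw [Finset.sum_range_succ _ (j + 1)]; ring) N
  simp only [sub_self] at h1
  have h2 := ha2.sum_le_tsum (Finset.range (N + 1)) fun _ _ => sq_nonneg _
  have h3 := Finset.sum_le_sum_of_subset_of_nonneg
    (f := fun j => (∑ k ∈ Finset.range (N + 1), a k - ∑ k ∈ Finset.range (j + 1), a k) ^ 2)
    (Finset.range_mono hN) fun _ _ _ => sq_nonneg _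
  linarith

/-- The tail sums `∑_{k > j} b_k`. -/
def tailSeq (b : ℤ → ℂ) : ℤ → ℂ := fun j => ∑' k : ℤ, if j < k then b k else 0

theorem summable_ite_of_absSummable {b : ℤ → ℂ} (hb : AbsSummable b) (P : ℤ → Prop)
    [DecidablePred P] : Summable fun k => if P k then b k else 0 := by
  refine Summable.of_norm_bounded hb fun k => ?_
  split_ifs <;> simp

theorem tailSeq_sub_one {b : ℤ → ℂ} (hb : AbsSummable b) (j : ℤ) :
    tailSeq b (j - 1) = b j + tailSeq b j := by
  rw [tailSeq, tailSeq, ← tsum_ite_eq j (fun _ => b j),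
    ← Summable.tsum_add (hasSum_ite_eq j (b j)).summable (summable_ite_of_absSummable hb _)]
  refine tsum_congr fun k => ?_
  rcases lt_trichotomy j k with h | h | h
  · simp [h, h.ne', show j - 1 < k by omega]
  · simp [h]
  · simp [h.ne, not_lt.2 h.le, show ¬ j - 1 < k by omega]

theorem hsumm_tailSeq {b : ℤ → ℂ} (hb : hsumm 1 b) (h0 : ∑' k, b k = 0) :
    hsumm 0 (tailSeq b) := by
  have bs := hb.absSummable le_rfl
  have hD : Summable fun n => ‖derivSeq b n‖ ^ 2 :=
    hsumm_zero_iff.1 (hsumm.derivSeq (by simpa using hb))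
  have key : ∀ c : ℕ → ℂ, Summable (fun k => ‖c k‖) →
      Summable (fun k : ℕ => ((k : ℝ) * ‖c k‖) ^ 2) → ∀ τ : ℕ → ℂ,
      (∀ n, ‖τ n‖ = ‖∑' k, c (k + (n + 1))‖) → Summable fun n => ‖τ n‖ ^ 2 := by
    intro c hc hc2 τ hτ
    refine Summable.of_nonneg_of_le (fun _ => sq_nonneg _) (fun n => ?_) (summable_sq_tail hc hc2)
    rw [hτ]
    exact pow_le_pow_left₀ (norm_nonneg _)
      (norm_tsum_le_tsum_norm ((summable_nat_add_iff (f := fun k => ‖c k‖) (n + 1)).2 hc)) 2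
  have hinj : Function.Injective fun k : ℕ => -(k : ℤ) := fun i j h => by simpa using h
  refine hsumm_zero_iff.2 (Summable.of_nat_of_neg_add_one ?_ ?_)
  · refine key (fun k => b k) (Summable.comp_injective bs (i := fun k : ℕ => (k : ℤ)) Nat.cast_injective) ?_ _ fun n => ?_
    · refine (hD.comp_injective Nat.cast_injective).congr fun k => ?_
      simp [derivSeq]
    · rw [tailSeq, ← Function.Injective.tsum_eq (g := fun k : ℕ => (k : ℤ) + (n + 1))
        (fun i j h => by simpa using h)]
      · refine congrArg _ (tsum_congr fun k => ?_)
        rw [if_pos (by omega)]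
        push_cast
        rfl
      · intro k hk
        have h1 : (n : ℤ) < k := by
          by_contra h
          simp [h] at hk
        exact ⟨(k - (n + 1)).toNat, by simp only; omega⟩
  · refine key (fun k => b (-(k : ℤ))) (Summable.comp_injective (f := fun j => ‖b j‖) bs hinj) ?_ _ fun n => ?_
    · refine (hD.comp_injective hinj).congr fun k => ?_
      simp [derivSeq]
    · have h1 : tailSeq b (-(n + 1 : ℤ)) = -∑' k, if k ≤ -(n + 1 : ℤ) then b k else 0 := by
        rw [eq_neg_iff_add_eq_zero, tailSeq,
          ← Summable.tsum_add (summable_ite_of_absSummable bs _) (summable_ite_of_absSummable bs _)]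
        refine Eq.trans ?_ h0
        refine tsum_congr fun k => ?_
        rcases lt_or_ge (-(n + 1 : ℤ)) k with h | h
        · rw [if_pos h, if_neg (not_le.2 h), add_zero]
        · rw [if_neg (not_lt.2 h), if_pos h, zero_add]
      rw [h1, norm_neg, ← Function.Injective.tsum_eq (g := fun k : ℕ => -((k : ℤ) + (n + 1)))
        (fun i j h => by simpa using h)]
      · refine congrArg _ (tsum_congr fun k => ?_)
        rw [if_pos (by omega)]
        push_cast
        rfl
      · intro k hk
        have h1 : k ≤ -(n + 1 : ℤ) := by
          by_contra h
          exact hk (if_neg h)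
        exact ⟨(-k - (n + 1)).toNat, by simp only; omega⟩

/-- A function in `H¹` vanishing at `z ∈ 𝕌` is `ζ - z` times a function in `L²`, and the
quotient of a function with only nonnegative (nonpositive) modes has only nonnegative (negative)
modes. -/
theorem exists_div_of_eval_eq_zero {f : ℤ → ℂ} (hf : hsumm 1 f) {z : ℂ} (hz : ‖z‖ = 1)
    (h0 : ∑' j : ℤ, f j * z ^ j = 0) :
    ∃ p : ℤ → ℂ, hsumm 0 p ∧ (∀ j, f j = p (j - 1) - z * p j) ∧
      ((∀ j < 0, f j = 0) → ∀ j < 0, p j = 0) ∧ ((∀ j > 0, f j = 0) → ∀ j ≥ 0, p j = 0) := by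
  have hz0 : z ≠ 0 := fun h => by simp [h] at hz
  set b : ℤ → ℂ := fun j => f j * z ^ j with hb
  have hb1 : hsumm 1 b := hf.of_norm_le fun j => by simp [hb, hz]
  refine ⟨fun j => z ^ (-j - 1) * tailSeq b j, ?_, fun j => ?_, fun h j hj => ?_,
    fun h j hj => ?_⟩
  · exact (hsumm_tailSeq hb1 h0).of_norm_le fun j => by simp [hz]
  · have h1 : z * (z ^ (-j - 1) * tailSeq b j) = z ^ (-j) * tailSeq b j := by
      rw [← mul_assoc, ← zpow_one_add₀ hz0]
      ring_nf
    have h2 : -(j - 1) - 1 = -j := by ring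
    simp only [h1, h2, tailSeq_sub_one (hb1.absSummable le_rfl)]
    rw [mul_add, add_sub_cancel_right, hb, mul_left_comm, ← zpow_add₀ hz0]
    simp
  · have h1 : tailSeq b j = 0 := by
      rw [← h0, tailSeq]
      refine tsum_congr fun k => ?_
      by_cases hk : j < k
      · rw [if_pos hk]
      · simp [hk, h k (by omega)]
    simp [h1]
  · have h1 : tailSeq b j = 0 := by
      rw [tailSeq, ← tsum_zero (β := ℤ)]
      refine tsum_congr fun k => ?_
      by_cases hk : j < k
      · simp [hb, h k (by omega)]
      · simp [hk]
    simp [h1]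

theorem cmul_zpow_neg {a : ℤ → ℂ} {z : ℂ} (hz : z ≠ 0) :
    cmul a (fun j => z ^ (-j)) = fun n => (∑' j : ℤ, a j * z ^ j) * z ^ (-n) := by
  funext n
  rw [cmul, ← tsum_mul_right, ← (Equiv.subLeft n).tsum_eq]
  refine tsum_congr fun j => ?_
  have : z ^ (-(n - j)) = z ^ j * z ^ (-n) := by
    rw [← zpow_add₀ hz]
    ring_nf
  simp only [Equiv.subLeft_apply, sub_sub_cancel, this, mul_assoc]

theorem eval_cmul {a b : ℤ → ℂ} (ha : AbsSummable a) (hb : AbsSummable b) {z : ℂ}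
    (hz : ‖z‖ = 1) : ∑' j : ℤ, cmul a b j * z ^ j
      = (∑' j : ℤ, a j * z ^ j) * ∑' j : ℤ, b j * z ^ j := by
  have hz0 : z ≠ 0 := fun h => by simp [h] at hz
  have h1 := cmul_assoc ha hb (c := fun j => z ^ (-j)) ⟨1, fun j => by simp [hz]⟩
  rw [cmul_zpow_neg hz0, cmul_zpow_neg hz0] at h1
  have h2 : cmul a (fun n => (∑' j : ℤ, b j * z ^ j) * z ^ (-n))
      = fun n => (∑' j : ℤ, b j * z ^ j) * cmul a (fun j => z ^ (-j)) n := by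
    funext n
    rw [cmul, cmul, ← tsum_mul_left]
    exact tsum_congr fun j => by ring
  rw [h2, cmul_zpow_neg hz0] at h1
  have h3 := congrFun h1 0
  simp only [neg_zero, zpow_zero, mul_one] at h3
  rw [h3, mul_comm]

theorem eq_zero_of_geometric {r : ℤ → ℂ} (hr : hsumm 0 r) {z : ℂ} (hz : ‖z‖ = 1)
    (h : ∀ j, r (j - 1) = z * r j) : r = 0 := by
  have h1 : ∀ j, ‖r (j - 1)‖ = ‖r j‖ := fun j => by rw [h, norm_mul, hz, one_mul]
  have h2 : ∀ j, ‖r j‖ = ‖r 0‖ := by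
    intro j
    induction j using Int.induction_on with
    | zero => rfl
    | succ i ih => rw [← ih, ← h1 (i + 1), add_sub_cancel_right]
    | pred i ih => rw [h1, ih]
  have h3 := hsumm_zero_iff.1 hr
  simp only [h2] at h3
  have h4 := (summable_const_iff _).1 h3
  funext j
  have h5 : ‖r 0‖ = 0 := by simpa using h4
  exact norm_eq_zero.1 ((h2 j).trans h5)

/-! ### Cauchy projections -/

theorem Cpl_sub_Cmn (u : ℤ → ℂ) : Cpl u - Cmn u = u := by
  funext j
  rcases lt_or_ge j 0 with h | h
  · simp [Cpl, Cmn, h, not_le.2 h]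
  · simp [Cpl, Cmn, h, not_lt.2 h]

theorem Cpl_add (u v : ℤ → ℂ) : Cpl (u + v) = Cpl u + Cpl v := by
  funext j
  simp only [Cpl, Pi.add_apply]
  split_ifs <;> simp

theorem Cmn_add (u v : ℤ → ℂ) : Cmn (u + v) = Cmn u + Cmn v := by
  funext j
  simp only [Cmn, Pi.add_apply]
  split_ifs <;> simp [add_comm]

theorem Cpl_sub_of_support {X Y : ℤ → ℂ} (hX : ∀ j < 0, X j = 0) (hY : ∀ j ≥ 0, Y j = 0) :
    Cpl (X - Y) = X := by
  funext j
  rcases lt_or_ge j 0 with h | h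
  · simp [Cpl, not_le.2 h, hX j h]
  · simp [Cpl, h, hY j h]

theorem Cmn_sub_of_support {X Y : ℤ → ℂ} (hX : ∀ j < 0, X j = 0) (hY : ∀ j ≥ 0, Y j = 0) :
    Cmn (X - Y) = Y := by
  funext j
  rcases lt_or_ge j 0 with h | h
  · simp [Cmn, h, hX j h]
  · simp [Cmn, not_lt.2 h, hY j h]

theorem cmul_eq_zero_of_neg {a b : ℤ → ℂ} (ha : ∀ j < 0, a j = 0) (hb : ∀ j < 0, b j = 0) :
    ∀ j < 0, cmul a b j = 0 := by
  intro n hn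
  rw [cmul, ← tsum_zero (β := ℤ)]
  refine tsum_congr fun j => ?_
  rcases lt_or_ge j 0 with h | h
  · simp [hb j h]
  · simp [ha (n - j) (by omega)]

theorem cmul_eq_zero_of_nonneg {a b : ℤ → ℂ} (ha : ∀ j > 0, a j = 0) (hb : ∀ j ≥ 0, b j = 0) :
    ∀ j ≥ 0, cmul a b j = 0 := by
  intro n hn
  rw [cmul, ← tsum_zero (β := ℤ)]
  refine tsum_congr fun j => ?_
  rcases lt_or_ge j 0 with h | h
  · simp [ha (n - j) (by omega)]
  · simp [hb j h]

theorem sub_cmul_Cmn {g w : ℤ → ℂ} (hg : AbsSummable g) (hw : BddSeq (Cmn w)) :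
    w - cmul (g - one1) (Cmn w) = Cpl w - cmul g (Cmn w) := by
  rw [sub_cmul hg absSummable_one1 hw, one1_cmul]
  nth_rewrite 1 [← Cpl_sub_Cmn w]
  abel

/-- Uniqueness for the Riemann–Hilbert problem makes `𝒞⁺ - 𝓜(g)𝒞⁻` injective on `L²`. -/
theorem eq_zero_of_unique {g u : ℤ → ℂ} (hg : AbsSummable g) (hu0 : hsumm 0 u)
    (hueq : Cpl u - cmul g (Cmn u) = g - one1)
    (huniq : ∀ u' : ℤ → ℂ, hsumm 0 u' → Cpl u' - cmul g (Cmn u') = g - one1 → u' = u)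
    {w : ℤ → ℂ} (hw : hsumm 0 w) (h : Cpl w - cmul g (Cmn w) = 0) : w = 0 := by
  have h1 := huniq (u + w) (hu0.add hw) (by
    rw [Cpl_add, Cmn_add, cmul_add hg (hu0.Cmn.bddSeq le_rfl) (hw.Cmn.bddSeq le_rfl),
      add_sub_add_comm, hueq, h, add_zero])
  simpa using h1

theorem eval_ne_zero_of_nonvanishing {g : ℤ → ℂ} (hnv : nonvanishing g) {z : ℂ} (hz : ‖z‖ = 1) :
    ∑' j : ℤ, g j * z ^ j ≠ 0 := by
  obtain ⟨ε, hε, h⟩ := hnv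
  have h1 : z = Complex.exp (Complex.I * (z.arg : ℂ)) := by
    have := Complex.norm_mul_exp_arg_mul_I z
    rw [hz] at this
    simpa [mul_comm] using this.symm
  have h2 : ∀ j : ℤ, z ^ j = Complex.exp (Complex.I * (j : ℂ) * (z.arg : ℂ)) := by
    intro j
    nth_rewrite 1 [h1]
    rw [← Complex.exp_int_mul]
    ring_nf
  intro h3
  have h4 := h z.arg
  simp_rw [← h2] at h4
  rw [h3, norm_zero] at h4
  linarith

/-- A solution of the uniquely solvable Riemann–Hilbert problem `φ⁺ = g φ⁻` does not vanish
on `𝕌`. -/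
theorem eval_ne_zero_of_unique {g u φp φm : ℤ → ℂ} (hg : hsumm 1 g) (hnv : nonvanishing g)
    (hu0 : hsumm 0 u) (hueq : Cpl u - cmul g (Cmn u) = g - one1)
    (huniq : ∀ u' : ℤ → ℂ, hsumm 0 u' → Cpl u' - cmul g (Cmn u') = g - one1 → u' = u)
    (hp : hsumm 1 φp) (hm : hsumm 1 φm) (hpm : φp = cmul g φm)
    (hp0 : ∀ j < 0, φp j = 0) (hm0 : ∀ j > 0, φm j = 0) (hne : φm ≠ 0) {z : ℂ}
    (hz : ‖z‖ = 1) : ∑' j : ℤ, φp j * z ^ j ≠ 0 := by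
  intro hpz
  have gs := hg.absSummable le_rfl
  have hmz : ∑' j : ℤ, φm j * z ^ j = 0 := by
    rw [hpm, eval_cmul gs (hm.absSummable le_rfl) hz] at hpz
    exact (mul_eq_zero.1 hpz).resolve_left (eval_ne_zero_of_nonvanishing hnv hz)
  obtain ⟨p, hps, hpd, hpp, -⟩ := exists_div_of_eval_eq_zero hp hz hpz
  obtain ⟨q, hqs, hqd, -, hqm⟩ := exists_div_of_eval_eq_zero hm hz hmz
  have hgq : hsumm 0 (cmul g q) := hsumm.cmul le_rfl le_rfl zero_le_one hg hqs
  have hr : p - cmul g q = 0 := by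
    refine eq_zero_of_geometric (hps.sub hgq) hz fun j => ?_
    have h1 := summable_cmul gs (hqs.bddSeq le_rfl) j
    have h2 : Summable fun k => g (j - k) * q (k - 1) := by
      have := (Equiv.subRight (1 : ℤ)).summable_iff.2
        (summable_cmul gs (hqs.bddSeq le_rfl) (j - 1))
      refine this.congr fun k => ?_
      simp
    have h3 : ∑' k, g (j - k) * q (k - 1) = cmul g q (j - 1) := by
      rw [cmul, ← (Equiv.subRight (1 : ℤ)).tsum_eq fun k => g (j - 1 - k) * q k]
      exact tsum_congr fun k => by simp
    have h4 : φp j = cmul g q (j - 1) - z * cmul g q j := by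
      rw [hpm, ← h3, cmul, cmul, ← tsum_mul_left, ← h2.tsum_sub (h1.mul_left z)]
      refine tsum_congr fun k => ?_
      rw [hqd]
      ring
    have h5 := hpd j
    rw [h4] at h5
    simp only [Pi.sub_apply]
    linear_combination -h5
  have hw : p - q = 0 := by
    refine eq_zero_of_unique gs hu0 hueq huniq (hps.sub hqs) ?_
    rw [Cpl_sub_of_support (hpp hp0) (hqm hm0), Cmn_sub_of_support (hpp hp0) (hqm hm0), hr]
  have hq : q = 0 := by
    have := Cmn_sub_of_support (hpp hp0) (hqm hm0)
    rw [hw] at this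
    rw [← this]
    funext j
    simp [Cmn]
  refine hne (funext fun j => ?_)
  simp [hqd, hq]

/-- **Statement 17.** With `φ⁺ = 1 + 𝒞⁺u` and `φ⁻ = 1 + 𝒞⁻u` built from the solution `u`
of the Riemann–Hilbert problem, `φ⁺` is invertible in the algebra `H^t` and
`(id - 𝓜(g-1)𝒞⁻)⁻¹ = 𝓜(φ⁺)𝒞⁺𝓜((φ⁺)⁻¹) - 𝓜(φ⁻)𝒞⁻𝓜((φ⁺)⁻¹)` on `L²`. -/
theorem inverse_formula_RHP
    (t : ℝ) (ht : 1 ≤ t)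
    (g : ℤ → ℂ) (hg : hsumm t g) (hnv : nonvanishing g)
    (u : ℤ → ℂ) (hu0 : hsumm 0 u) (hut : hsumm t u)
    (hueq : Cpl u - cmul g (Cmn u) = g - one1)
    (huniq : ∀ u' : ℤ → ℂ, hsumm 0 u' → Cpl u' - cmul g (Cmn u') = g - one1 → u' = u) :
    ∃ ψ : ℤ → ℂ, hsumm t ψ ∧ cmul (one1 + Cpl u) ψ = one1 ∧
      ∀ v : ℤ → ℂ, hsumm 0 v →
        hsumm 0 (cmul (one1 + Cpl u) (Cpl (cmul ψ v))
          - cmul (one1 + Cmn u) (Cmn (cmul ψ v))) ∧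
        ((cmul (one1 + Cpl u) (Cpl (cmul ψ v)) - cmul (one1 + Cmn u) (Cmn (cmul ψ v)))
            - cmul (g - one1) (Cmn (cmul (one1 + Cpl u) (Cpl (cmul ψ v))
                - cmul (one1 + Cmn u) (Cmn (cmul ψ v)))) = v) ∧
        (cmul (one1 + Cpl u) (Cpl (cmul ψ (v - cmul (g - one1) (Cmn v))))
          - cmul (one1 + Cmn u) (Cmn (cmul ψ (v - cmul (g - one1) (Cmn v)))) = v) := by
  have ht0 : (0 : ℝ) ≤ t := by linarith
  set φp := one1 + Cpl u with hφp
  set φm := one1 + Cmn u with hφm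
  have gs : AbsSummable g := hg.absSummable ht
  have hp : hsumm t φp := (hsumm_one1 t).add hut.Cpl
  have hm : hsumm t φm := (hsumm_one1 t).add hut.Cmn
  have ps := hp.absSummable ht
  have ms := hm.absSummable ht
  have hpm : φp = cmul g φm := by
    rw [hφm, cmul_add gs absSummable_one1.bddSeq (hu0.Cmn.bddSeq le_rfl), cmul_comm g one1,
      one1_cmul, hφp, ← sub_eq_zero, ← sub_eq_zero.2 hueq]
    abel
  have hp0 : ∀ j < 0, φp j = 0 := fun j hj => by
    simp [hφp, one1, Cpl, hj.ne, not_le.2 hj]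
  have hm0 : ∀ j > 0, φm j = 0 := fun j hj => by
    simp [hφm, one1, Cmn, hj.ne', not_lt.2 (le_of_lt hj)]
  have hne : φm ≠ 0 := fun h => by
    have := congrFun h 0
    simp [hφm, one1, Cmn] at this
  obtain ⟨ψ, hψ1, hψ⟩ := exists_hsumm_one_inverse (hp.mono ht) fun z hz =>
    eval_ne_zero_of_unique (hg.mono ht) hnv hu0 hueq huniq (hp.mono ht) (hm.mono ht) hpm hp0 hm0
      hne hz
  have hψt : hsumm t ψ := hsumm_inverse ht hp hψ1 hψ
  have ψs := hψt.absSummable ht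
  have mulL2 : ∀ {a w : ℤ → ℂ}, hsumm t a → hsumm 0 w → hsumm 0 (cmul a w) :=
    fun ha hw => hsumm.cmul ht le_rfl ht0 ha hw
  have hR : ∀ v : ℤ → ℂ, hsumm 0 v →
      hsumm 0 (cmul φp (Cpl (cmul ψ v)) - cmul φm (Cmn (cmul ψ v))) := fun v hv =>
    (mulL2 hp (mulL2 hψt hv).Cpl).sub (mulL2 hm (mulL2 hψt hv).Cmn)
  have hAR : ∀ v : ℤ → ℂ, hsumm 0 v →
      Cpl (cmul φp (Cpl (cmul ψ v)) - cmul φm (Cmn (cmul ψ v)))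
        - cmul g (Cmn (cmul φp (Cpl (cmul ψ v)) - cmul φm (Cmn (cmul ψ v)))) = v := by
    intro v hv
    have hψv := mulL2 hψt hv
    have hX : ∀ j < 0, cmul φp (Cpl (cmul ψ v)) j = 0 :=
      cmul_eq_zero_of_neg hp0 fun j hj => by simp [Cpl, not_le.2 hj]
    have hY : ∀ j ≥ 0, cmul φm (Cmn (cmul ψ v)) j = 0 :=
      cmul_eq_zero_of_nonneg hm0 fun j hj => by simp [Cmn, not_lt.2 hj]
    rw [Cpl_sub_of_support hX hY, Cmn_sub_of_support hX hY,
      ← cmul_assoc gs ms (hψv.Cmn.bddSeq le_rfl), ← hpm,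
      ← cmul_sub ps (hψv.Cpl.bddSeq le_rfl) (hψv.Cmn.bddSeq le_rfl), Cpl_sub_Cmn,
      ← cmul_assoc ps ψs (hv.bddSeq le_rfl), hψ, one1_cmul]
  refine ⟨ψ, hψt, hψ, fun v hv => ⟨hR v hv, ?_, ?_⟩⟩
  · rw [sub_cmul_Cmn gs ((hR v hv).Cmn.bddSeq le_rfl), hAR v hv]
  · rw [sub_cmul_Cmn gs (hv.Cmn.bddSeq le_rfl)]
    have hAv : hsumm 0 (Cpl v - cmul g (Cmn v)) := hv.Cpl.sub (mulL2 hg hv.Cmn)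
    have h1 := hAR _ hAv
    have h2 := hR _ hAv
    set r := cmul φp (Cpl (cmul ψ (Cpl v - cmul g (Cmn v))))
      - cmul φm (Cmn (cmul ψ (Cpl v - cmul g (Cmn v)))) with hr
    have h3 := eq_zero_of_unique gs hu0 hueq huniq (h2.sub hv) (by
      have e1 : Cpl (r - v) = Cpl r - Cpl v := by
        rw [eq_sub_iff_add_eq, ← Cpl_add, sub_add_cancel]
      have e2 : Cmn (r - v) = Cmn r - Cmn v := by
        rw [eq_sub_iff_add_eq, ← Cmn_add, sub_add_cancel]
      rw [e1, e2, cmul_sub gs (h2.Cmn.bddSeq le_rfl) (hv.Cmn.bddSeq le_rfl), sub_sub_sub_comm, h1,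
        sub_self])
    exact sub_eq_zero.1 h3

end
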